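/- arXiv:1607.07044 — 7 statements merged into one kernel-verified Lean document; each statement's English description precedes it below -/
import Mathlib

section
/- The regularized entropy density h̃ is strictly convex on S°; i.e. h̃ : ℝ × ℝ → ℝ restricted to the convex open set S° is strictly convex (StrictConvexOn ℝ S° h̃). -/
theorem strictConvexOn_mul_log_sub_one :
    StrictConvexOn ℝ (Set.Ioi 0) (fun x : ℝ => x * (Real.log x - 1)) := by
  refine ⟨convex_Ioi 0, fun x hx y hy hxy a b ha hb hab => ?_⟩
  have h := Real.strictConvexOn_mul_log.2 (Set.Ioi_subset_Ici_self hx)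
    (Set.Ioi_subset_Ici_self hy) hxy ha hb hab
  simp only [smul_eq_mul] at h ⊢
  linarith

/-- Lemma 1 of the paper (strict convexity part): the regularized entropy density
`h̃(r,b) = r(log r − 1) + b(log b − 1) + r V_r + b V_b + (ᾱ/2)(r+b)²
          + τ(1 − γ̄(r+b))(log(1 − γ̄(r+b)) − 1)`
is strictly convex on `S° = {(r,b) : r > 0, b > 0, r + b < 1/γ̄}`. -/
theorem strictConvexOn_regularized_entropy_density
    (γ ᾱ τ Vr Vb : ℝ) (hγ : 0 < γ) (hᾱ : 0 ≤ ᾱ) (hτ : 0 < τ) :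
    StrictConvexOn ℝ
      {p : ℝ × ℝ | 0 < p.1 ∧ 0 < p.2 ∧ p.1 + p.2 < 1 / γ}
      (fun p : ℝ × ℝ =>
        p.1 * (Real.log p.1 - 1) + p.2 * (Real.log p.2 - 1)
          + p.1 * Vr + p.2 * Vb + ᾱ / 2 * (p.1 + p.2) ^ 2
          + τ * (1 - γ * (p.1 + p.2)) * (Real.log (1 - γ * (p.1 + p.2)) - 1)) := by
  have hpos : ∀ s : ℝ, s < 1 / γ → 0 < 1 - γ * s := fun s hs => by
    rw [lt_div_iff₀ hγ] at hs
    linarith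
  have hconv := strictConvexOn_mul_log_sub_one.convexOn
  refine ⟨?_, ?_⟩
  · exact (convex_halfSpace_gt (LinearMap.fst ℝ ℝ ℝ).isLinear 0).inter
      ((convex_halfSpace_gt (LinearMap.snd ℝ ℝ ℝ).isLinear 0).inter
        (convex_halfSpace_lt (LinearMap.fst ℝ ℝ ℝ + LinearMap.snd ℝ ℝ ℝ).isLinear (1 / γ)))
  rintro ⟨x₁, x₂⟩ ⟨hx₁, hx₂, hx⟩ ⟨y₁, y₂⟩ ⟨hy₁, hy₂, hy⟩ hne a b ha hb hab
  dsimp only at hx₁ hx₂ hx hy₁ hy₂ hy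
  have h₁ := hconv.2 (Set.mem_Ioi.2 hx₁) (Set.mem_Ioi.2 hy₁) ha.le hb.le hab
  have h₂ := hconv.2 (Set.mem_Ioi.2 hx₂) (Set.mem_Ioi.2 hy₂) ha.le hb.le hab
  have h₃ := mul_le_mul_of_nonneg_left
    (hconv.2 (Set.mem_Ioi.2 (hpos _ hx)) (Set.mem_Ioi.2 (hpos _ hy)) ha.le hb.le hab) hτ.le
  have h₄ := mul_le_mul_of_nonneg_left
    ((even_two.convexOn_pow (𝕜 := ℝ)).2 (Set.mem_univ (x₁ + x₂)) (Set.mem_univ (y₁ + y₂))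
      ha.le hb.le hab) (div_nonneg hᾱ zero_le_two)
  have haff : 1 - γ * (a * x₁ + b * y₁ + (a * x₂ + b * y₂)) =
      a * (1 - γ * (x₁ + x₂)) + b * (1 - γ * (y₁ + y₂)) := by
    linear_combination -hab
  have hsum : a * x₁ + b * y₁ + (a * x₂ + b * y₂) = a * (x₁ + x₂) + b * (y₁ + y₂) := by ring
  simp only [Prod.smul_mk, Prod.mk_add_mk, smul_eq_mul] at h₁ h₂ h₃ h₄ ⊢
  rw [haff, hsum]
  rcases ne_or_eq x₁ y₁ with h | rfl
  · have h₁' := strictConvexOn_mul_log_sub_one.2 (Set.mem_Ioi.2 hx₁) (Set.mem_Ioi.2 hy₁) h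
      ha hb hab
    simp only [smul_eq_mul] at h₁'
    linarith
  · have h₂' := strictConvexOn_mul_log_sub_one.2 (Set.mem_Ioi.2 hx₂) (Set.mem_Ioi.2 hy₂)
      (fun h => hne (by rw [h])) ha hb hab
    simp only [smul_eq_mul] at h₂'
    linarith
end

section
/- The gradient of the regularized entropy density, h̃'(r,b) = (log r − τγ̄·log(1 − γ̄(r+b)) + ᾱ(r+b) + V_r, log b − τγ̄·log(1 − γ̄(r+b)) + ᾱ(r+b) + V_b), is a bijection from S° onto ℝ × ℝ. -/
open Set

/-- The common nonlinear part of the two gradient components is monotone on `s < 1 / γ`. -/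
lemma neg_log_one_sub_add_linear_monotoneOn {γ α τ : ℝ} (hγ : 0 < γ) (hα : 0 ≤ α) (hτ : 0 ≤ τ) :
    MonotoneOn (fun s : ℝ => -(τ * γ * Real.log (1 - γ * s)) + α * s) (Iio (1 / γ)) := by
  intro s _ t ht hst
  have ht' : 0 < 1 - γ * t := by
    have := (lt_div_iff₀' hγ).1 ht
    linarith
  have hlog : Real.log (1 - γ * t) ≤ Real.log (1 - γ * s) := by gcongr
  have hmul := mul_le_mul_of_nonneg_left hlog (mul_nonneg hτ hγ.le)
  have hlin := mul_le_mul_of_nonneg_left hst hα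
  dsimp only
  linarith

lemma exists_log_sub_log_one_sub_add_linear_eq {γ τ : ℝ} (α c : ℝ) (hγ : 0 < γ) (hτ : 0 < τ) :
    ∃ s ∈ Ioo 0 (1 / γ), Real.log s - τ * γ * Real.log (1 - γ * s) + α * s = c := by
  have hτγ : 0 < τ * γ := mul_pos hτ hγ
  let g : ℝ → ℝ := fun s => (1 - γ * s) ^ (τ * γ) * Real.exp (c - α * s) - s
  have hg : Continuous g := by
    have : Continuous fun s : ℝ => (1 - γ * s) ^ (τ * γ) :=
      (by fun_prop : Continuous fun s : ℝ => 1 - γ * s).rpow_const fun _ => Or.inr hτγ.le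
    fun_prop
  have hright : g (1 / γ) < 0 := by
    simp [g, mul_inv_cancel₀ hγ.ne', Real.zero_rpow hτγ.ne', hγ]
  have hleft : 0 < g 0 := by
    simp [g, Real.exp_pos]
  obtain ⟨s, hs, hs0⟩ :=
    intermediate_value_Ioo' (one_div_pos.2 hγ).le hg.continuousOn ⟨hright, hleft⟩
  refine ⟨s, hs, ?_⟩
  have hpos : 0 < 1 - γ * s := by
    have := (lt_div_iff₀' hγ).1 hs.2
    linarith
  have hlog : Real.log s = τ * γ * Real.log (1 - γ * s) + (c - α * s) := by
    rw [← Real.log_rpow hpos, ← Real.log_exp (c - α * s),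
      ← Real.log_mul (Real.rpow_pos_of_pos hpos _).ne' (Real.exp_pos _).ne']
    exact congrArg Real.log (sub_eq_zero.1 hs0).symm
  linarith

/-- Lemma 1 of the paper (invertibility of the gradient of the regularized entropy):
`h̃'(r,b) = (log r − τγ̄ log(1 − γ̄(r+b)) + ᾱ(r+b) + V_r,
            log b − τγ̄ log(1 − γ̄(r+b)) + ᾱ(r+b) + V_b)`
is a bijection from `S° = {(r,b) : r > 0, b > 0, r + b < 1/γ̄}` onto `ℝ × ℝ`. -/
theorem regularized_entropy_gradient_bijOn
    (γ ᾱ τ Vr Vb : ℝ) (hγ : 0 < γ) (hᾱ : 0 ≤ ᾱ) (hτ : 0 < τ) :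
    Set.BijOn
      (fun p : ℝ × ℝ =>
        (Real.log p.1 - τ * γ * Real.log (1 - γ * (p.1 + p.2)) + ᾱ * (p.1 + p.2) + Vr,
         Real.log p.2 - τ * γ * Real.log (1 - γ * (p.1 + p.2)) + ᾱ * (p.1 + p.2) + Vb))
      {p : ℝ × ℝ | 0 < p.1 ∧ 0 < p.2 ∧ p.1 + p.2 < 1 / γ}
      Set.univ := by
  refine ⟨fun _ _ => mem_univ _, ?_, ?_⟩
  · rintro ⟨r, b⟩ ⟨hr, hb, hs⟩ ⟨r', b'⟩ ⟨hr', hb', hs'⟩ h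
    obtain ⟨h₁, h₂⟩ := Prod.mk.inj h
    dsimp only at hr hb hs hr' hb' hs' h₁ h₂
    have hmono := neg_log_one_sub_add_linear_monotoneOn hγ hᾱ hτ.le
    have hsum : r + b = r' + b' := by
      rcases le_total (r + b) (r' + b') with hle | hle
      · have hφ := hmono hs hs' hle
        dsimp only at hφ
        have hrr : r' ≤ r := (Real.log_le_log_iff hr' hr).1 (by linarith)
        have hbb : b' ≤ b := (Real.log_le_log_iff hb' hb).1 (by linarith)
        linarith
      · have hφ := hmono hs' hs hle
        dsimp only at hφ
        have hrr : r ≤ r' := (Real.log_le_log_iff hr hr').1 (by linarith)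
        have hbb : b ≤ b' := (Real.log_le_log_iff hb hb').1 (by linarith)
        linarith
    rw [hsum] at h₁
    have hrr : r = r' := Real.log_injOn_pos hr hr' (by linarith)
    exact Prod.ext hrr (by dsimp only; linarith)
  · rintro ⟨x, y⟩ -
    have hC : 0 < Real.exp (x - Vr) + Real.exp (y - Vb) := by positivity
    set C := Real.exp (x - Vr) + Real.exp (y - Vb) with hCdef
    obtain ⟨s, ⟨hs0, hs1⟩, hs⟩ :=
      exists_log_sub_log_one_sub_add_linear_eq ᾱ (Real.log C) hγ hτ
    have hsum : Real.exp (x - Vr) * (s / C) + Real.exp (y - Vb) * (s / C) = s := by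
      rw [← add_mul, ← hCdef, mul_div_cancel₀ _ hC.ne']
    have hlog (z : ℝ) : Real.log (Real.exp z * (s / C)) = z + (Real.log s - Real.log C) := by
      rw [Real.log_mul (Real.exp_pos z).ne' (div_pos hs0 hC).ne', Real.log_exp,
        Real.log_div hs0.ne' hC.ne']
    refine ⟨(Real.exp (x - Vr) * (s / C), Real.exp (y - Vb) * (s / C)),
      ⟨by positivity, by positivity, hsum.trans_lt hs1⟩, ?_⟩
    dsimp only
    rw [hsum, hlog, hlog]
    exact Prod.ext (by dsimp only; linarith) (by dsimp only; linarith)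
end

section
/- There exists a constant K > 0 such that for every (r,b) ∈ S° the matrix H(r,b) = [[1/r + c, c],[c, 1/b + c]], with c = τγ̄²/(1 − γ̄(r+b)) + ᾱ, is invertible and every entry of its inverse H(r,b)⁻¹ has absolute value at most K. -/
/-- For `r, b > 0` and `c ≥ 0`, the matrix `[[1/r + c, c], [c, 1/b + c]]` has an explicit
right inverse. -/
theorem diagonal_add_const_mul_inverse {r b c : ℝ} (hr : 0 < r) (hb : 0 < b) (hc : 0 ≤ c) :
    (!![1 / r + c, c; c, 1 / b + c] : Matrix (Fin 2) (Fin 2) ℝ) *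
      !![r * (1 + c * b) / (1 + c * (r + b)), -(c * r * b / (1 + c * (r + b)));
         -(c * r * b / (1 + c * (r + b))), b * (1 + c * r) / (1 + c * (r + b))] = 1 := by
  have hd : 1 + c * (r + b) ≠ 0 := by positivity
  ext i j
  fin_cases i <;> fin_cases j <;> simp [Matrix.mul_apply, Fin.sum_univ_two] <;> field_simp <;> ring

/-- For `r, b > 0` and `c ≥ 0`, the entries of the inverse of `[[1/r + c, c], [c, 1/b + c]]` are
bounded by `r + b`, independently of `c`. -/
theorem abs_inv_diagonal_add_const_le {r b c : ℝ} (hr : 0 < r) (hb : 0 < b) (hc : 0 ≤ c)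
    (i j : Fin 2) :
    |(!![1 / r + c, c; c, 1 / b + c] : Matrix (Fin 2) (Fin 2) ℝ)⁻¹ i j| ≤ r + b := by
  have hd : 0 < 1 + c * (r + b) := by positivity
  have hcr : 0 ≤ c * r := by positivity
  have hcb : 0 ≤ c * b := by positivity
  have h₁ : |r * (1 + c * b) / (1 + c * (r + b))| ≤ r + b := by
    rw [abs_of_nonneg (by positivity), div_le_iff₀ hd]
    nlinarith [mul_nonneg hcr hr.le, mul_nonneg hcb hb.le, mul_nonneg hcr hb.le]
  have h₂ : |-(c * r * b / (1 + c * (r + b)))| ≤ r + b := by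
    rw [abs_neg, abs_of_nonneg (by positivity), div_le_iff₀ hd]
    nlinarith [mul_nonneg hcr hr.le, mul_nonneg hcb hb.le, mul_nonneg hcr hb.le]
  have h₃ : |b * (1 + c * r) / (1 + c * (r + b))| ≤ r + b := by
    rw [abs_of_nonneg (by positivity), div_le_iff₀ hd]
    nlinarith [mul_nonneg hcr hr.le, mul_nonneg hcb hb.le, mul_nonneg hcr hb.le]
  rw [Matrix.inv_eq_right_inv (diagonal_add_const_mul_inverse hr hb hc)]
  fin_cases i <;> fin_cases j
  · exact h₁
  · exact h₂
  · exact h₂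
  · exact h₃


/-- Lemma 1 of the paper: the inverse of the Hessian of the regularized entropy density
is uniformly bounded on `S°`. There exists a constant `K > 0` such that for every
`(r,b) ∈ S°` the Hessian `H(r,b) = [[1/r + c, c],[c, 1/b + c]]`,
`c = τγ̄²/(1 − γ̄(r+b)) + ᾱ`, is invertible and all entries of `H(r,b)⁻¹` are bounded
by `K` in absolute value. -/
theorem hessian_regularized_entropy_inverse_uniformly_bounded
    (γ ᾱ τ : ℝ) (hγ : 0 < γ) (hᾱ : 0 ≤ ᾱ) (hτ : 0 < τ) :
    ∃ K : ℝ, 0 < K ∧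
      ∀ r b : ℝ, 0 < r → 0 < b → r + b < 1 / γ →
        IsUnit
          (!![1 / r + (τ * γ ^ 2 / (1 - γ * (r + b)) + ᾱ), τ * γ ^ 2 / (1 - γ * (r + b)) + ᾱ;
              τ * γ ^ 2 / (1 - γ * (r + b)) + ᾱ, 1 / b + (τ * γ ^ 2 / (1 - γ * (r + b)) + ᾱ)] :
            Matrix (Fin 2) (Fin 2) ℝ) ∧
        ∀ i j : Fin 2,
          |((!![1 / r + (τ * γ ^ 2 / (1 - γ * (r + b)) + ᾱ), τ * γ ^ 2 / (1 - γ * (r + b)) + ᾱ;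
               τ * γ ^ 2 / (1 - γ * (r + b)) + ᾱ, 1 / b + (τ * γ ^ 2 / (1 - γ * (r + b)) + ᾱ)] :
             Matrix (Fin 2) (Fin 2) ℝ)⁻¹) i j| ≤ K := by
  refine ⟨1 / γ, by positivity, fun r b hr hb hrb => ?_⟩
  have hpos : 0 < 1 - γ * (r + b) := by
    have := (lt_div_iff₀ hγ).mp hrb
    linarith
  have hc : 0 ≤ τ * γ ^ 2 / (1 - γ * (r + b)) + ᾱ := by positivity
  exact ⟨IsUnit.of_mul_eq_one _ (diagonal_add_const_mul_inverse hr hb hc),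
    fun i j => (abs_inv_diagonal_add_const_le hr hb hc i j).trans hrb.le⟩
end

section
/- For every real κ > 0, the map g : S° → ℝ × ℝ defined by g(r,b) = (log r − κ·log(1 − γ̄(r+b)), log b − κ·log(1 − γ̄(r+b))) is a bijection from S° onto ℝ × ℝ. In particular, for every (x,y) ∈ ℝ × ℝ there exists a unique (r,b) ∈ S° with log r − κ·log(1 − γ̄(r+b)) = x and log b − κ·log(1 − γ̄(r+b)) = y. -/
open Set in
/-- The decreasing map `z ↦ A (1 - γ z) ^ κ` has a fixed point in `(0, 1 / γ)`. -/
theorem exists_fixedPoint_mul_one_sub_rpow {γ κ A : ℝ} (hγ : 0 < γ) (hκ : 0 < κ) (hA : 0 < A) :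
    ∃ z : ℝ, 0 < z ∧ z < 1 / γ ∧ A * (1 - γ * z) ^ κ = z := by
  have hcont : ContinuousOn (fun z : ℝ => z - A * (1 - γ * z) ^ κ) (Icc 0 (1 / γ)) := by
    refine (continuous_id.sub (continuous_const.mul ?_)).continuousOn
    exact (continuous_const.sub (continuous_const.mul continuous_id)).rpow_const
      fun _ => Or.inr hκ.le
  have hγ' : 0 < 1 / γ := by positivity
  have hmem : (0 : ℝ) ∈ Ioo ((0 : ℝ) - A * (1 - γ * 0) ^ κ)
      (1 / γ - A * (1 - γ * (1 / γ)) ^ κ) := by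
    rw [mul_one_div_cancel hγ.ne', sub_self, Real.zero_rpow hκ.ne']
    constructor
    · simpa using hA
    · simpa using hγ
  obtain ⟨z, hz, hfz⟩ := intermediate_value_Ioo hγ'.le hcont hmem
  exact ⟨z, hz.1, hz.2, (sub_eq_zero.mp hfz).symm⟩

theorem Real.log_sub_mul_log_eq_iff {r w : ℝ} (hr : 0 < r) (hw : 0 < w) (κ x : ℝ) :
    Real.log r - κ * Real.log w = x ↔ r = Real.exp x * w ^ κ := by
  rw [Real.rpow_def_of_pos hw, ← Real.exp_add, sub_eq_iff_eq_add, mul_comm κ,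
    ← Real.exp_eq_exp, Real.exp_log hr]

/-- The map `z ↦ A (1 - γ z) ^ κ` has at most one fixed point in `(-∞, 1 / γ)`. -/
theorem eq_of_fixedPoint_mul_one_sub_rpow {γ κ A z w : ℝ} (hγ : 0 < γ) (hκ : 0 < κ)
    (hA : 0 < A) (hz : 0 < 1 - γ * z) (hw : 0 < 1 - γ * w)
    (hfz : A * (1 - γ * z) ^ κ = z) (hfw : A * (1 - γ * w) ^ κ = w) : z = w := by
  have key : ∀ {u v : ℝ}, 0 < 1 - γ * v → A * (1 - γ * u) ^ κ = u →
      A * (1 - γ * v) ^ κ = v → u ≤ v → v ≤ u := by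
    intro u v hv hfu hfv huv
    calc v = A * (1 - γ * v) ^ κ := hfv.symm
      _ ≤ A * (1 - γ * u) ^ κ := by gcongr
      _ = u := hfu
  rcases le_total z w with h | h
  · exact h.antisymm (key hw hfz hfw h)
  · exact (key hz hfw hfz h).antisymm h

/-- From the proof of Lemma 1 of the paper: for every `κ > 0`, the map
`g(r,b) = (log r − κ log(1 − γ̄(r+b)), log b − κ log(1 − γ̄(r+b)))`
is a bijection from `S° = {(r,b) : r > 0, b > 0, r + b < 1/γ̄}` onto `ℝ × ℝ`;
in particular every `(x,y)` has a unique preimage in `S°`. -/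
theorem g_bijOn_and_unique_preimage (γ : ℝ) (hγ : 0 < γ) (κ : ℝ) (hκ : 0 < κ) :
    Set.BijOn
      (fun p : ℝ × ℝ =>
        (Real.log p.1 - κ * Real.log (1 - γ * (p.1 + p.2)),
         Real.log p.2 - κ * Real.log (1 - γ * (p.1 + p.2))))
      {p : ℝ × ℝ | 0 < p.1 ∧ 0 < p.2 ∧ p.1 + p.2 < 1 / γ}
      Set.univ ∧
    ∀ x y : ℝ, ∃! p : ℝ × ℝ,
      p ∈ {p : ℝ × ℝ | 0 < p.1 ∧ 0 < p.2 ∧ p.1 + p.2 < 1 / γ} ∧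
      Real.log p.1 - κ * Real.log (1 - γ * (p.1 + p.2)) = x ∧
      Real.log p.2 - κ * Real.log (1 - γ * (p.1 + p.2)) = y := by
  have hpos : ∀ p : ℝ × ℝ, p.1 + p.2 < 1 / γ → 0 < 1 - γ * (p.1 + p.2) := by
    intro p hp
    rw [lt_div_iff₀ hγ] at hp
    linarith
  have main : ∀ x y : ℝ, ∃! p : ℝ × ℝ,
      p ∈ {p : ℝ × ℝ | 0 < p.1 ∧ 0 < p.2 ∧ p.1 + p.2 < 1 / γ} ∧
      Real.log p.1 - κ * Real.log (1 - γ * (p.1 + p.2)) = x ∧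
      Real.log p.2 - κ * Real.log (1 - γ * (p.1 + p.2)) = y := by
    intro x y
    have hA : 0 < Real.exp x + Real.exp y := by positivity
    obtain ⟨z, -, hz, hfz⟩ := exists_fixedPoint_mul_one_sub_rpow hγ hκ hA
    have hwz : 0 < 1 - γ * z := by
      rw [lt_div_iff₀ hγ] at hz
      linarith
    have hsum : Real.exp x * (1 - γ * z) ^ κ + Real.exp y * (1 - γ * z) ^ κ = z := by
      rw [← add_mul, hfz]
    have hr : 0 < Real.exp x * (1 - γ * z) ^ κ := by positivity
    have hb : 0 < Real.exp y * (1 - γ * z) ^ κ := by positivity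
    refine ⟨(Real.exp x * (1 - γ * z) ^ κ, Real.exp y * (1 - γ * z) ^ κ),
      ⟨⟨hr, hb, hsum.trans_lt hz⟩, ?_, ?_⟩, ?_⟩
    · simp only [hsum]
      exact (Real.log_sub_mul_log_eq_iff hr hwz κ x).2 rfl
    · simp only [hsum]
      exact (Real.log_sub_mul_log_eq_iff hb hwz κ y).2 rfl
    · rintro p ⟨⟨hp1, hp2, hp⟩, hx, hy⟩
      have hwp := hpos p hp
      rw [Real.log_sub_mul_log_eq_iff hp1 hwp] at hx
      rw [Real.log_sub_mul_log_eq_iff hp2 hwp] at hy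
      have hfp : (Real.exp x + Real.exp y) * (1 - γ * (p.1 + p.2)) ^ κ = p.1 + p.2 := by
        rw [add_mul, ← hx, ← hy]
      have hpz := eq_of_fixedPoint_mul_one_sub_rpow hγ hκ hA hwp hwz hfp hfz
      rw [hpz] at hx hy
      exact Prod.ext hx hy
  refine ⟨⟨Set.mapsTo_univ _ _, ?_, ?_⟩, main⟩
  · intro p hp q hq hpq
    obtain ⟨h1, h2⟩ := Prod.ext_iff.1 hpq
    exact (main _ _).unique ⟨hp, h1, h2⟩ ⟨hq, rfl, rfl⟩
  · rintro ⟨x, y⟩ -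
    obtain ⟨p, ⟨hp, hx, hy⟩, -⟩ := main x y
    exact ⟨p, hp, Prod.ext hx hy⟩
end

section
/- Let d ≥ 1 be a natural number and let ε_r, ε_b, D_r, D_b be positive reals. Set ε_br = (ε_r + ε_b)/2, θ̂_r = D_b·ε_br^d − D_r·ε_r^d and θ̂_b = D_r·ε_br^d − D_b·ε_b^d. Then θ̂_r = 0 and θ̂_b = 0 if and only if ε_r = ε_b and D_r = D_b. -/
/-- End of Section 2 of the paper: with `ε_br = (ε_r + ε_b)/2`,
`θ̂_r = D_b ε_br^d − D_r ε_r^d` and `θ̂_b = D_r ε_br^d − D_b ε_b^d`, one has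
`θ̂_r = θ̂_b = 0` if and only if `ε_r = ε_b` and `D_r = D_b`; i.e. the only
parameter values for which the cross-diffusion system is an exact gradient flow
are equal particle sizes and equal diffusivities. -/
theorem theta_zero_iff_symmetric (d : ℕ) (hd : 1 ≤ d)
    (εr εb Dr Db : ℝ) (hεr : 0 < εr) (hεb : 0 < εb) (hDr : 0 < Dr) (hDb : 0 < Db) :
    (Db * ((εr + εb) / 2) ^ d - Dr * εr ^ d = 0 ∧
     Dr * ((εr + εb) / 2) ^ d - Db * εb ^ d = 0) ↔ (εr = εb ∧ Dr = Db) := by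
  constructor
  · rintro ⟨hr, hb⟩
    have hprod : Dr * Db * (((εr + εb) / 2) ^ 2) ^ d = Dr * Db * (εr * εb) ^ d := by
      rw [mul_pow, ← pow_mul, mul_comm 2 d, pow_mul]
      linear_combination (Dr * ((εr + εb) / 2) ^ d) * hr + (Dr * εr ^ d) * hb
    have hpow := mul_left_cancel₀ (mul_pos hDr hDb).ne' hprod
    have hmean : ((εr + εb) / 2) ^ 2 = εr * εb :=
      (pow_left_inj₀ (by positivity) (by positivity) (Nat.one_le_iff_ne_zero.mp hd)).mp hpow
    have hε : εr = εb := by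
      have : (εr - εb) ^ 2 = 0 := by linear_combination 4 * hmean
      exact sub_eq_zero.mp (pow_eq_zero_iff two_ne_zero |>.mp this)
    subst hε
    rw [add_self_div_two, sub_eq_zero] at hr
    exact ⟨rfl, (mul_right_cancel₀ (pow_pos hεr d).ne' hr).symm⟩
  · rintro ⟨rfl, rfl⟩
    simp
end

section
/- Let d ≥ 1 be a natural number, let D_r, D_b, ε_r, ε_b be positive reals, and define α = 2(d−1)π/d, γ_r = (2π/d)·D_r/(D_r+D_b), γ_b = (2π/d)·D_b/(D_r+D_b), β_r = (2π/d)·((d−1)D_r + d·D_b)/(D_r+D_b), β_b = (2π/d)·((d−1)D_b + d·D_r)/(D_r+D_b), ε_br = (ε_r+ε_b)/2, θ̂_r = D_b·ε_br^d − D_r·ε_r^d, θ̂_b = D_r·ε_br^d − D_b·ε_b^d. Then for all reals r > 0, b > 0 and all vectors p, q, P, Q in a real inner product space E, the following two identities hold: (red component) D_r·((1 + ε_r^d·α·r)·p + r·P + ε_br^d·(β_r·r·q − γ_r·b·p + r·b·(γ_b·Q − γ_r·P))) = D_r·r·(1 − γ_r·ε_br^d·b)·(r⁻¹·p + P + α·(ε_r^d·p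 + ε_br^d·q)) + D_r·γ_b·ε_br^d·r·b·(b⁻¹·q + Q + α·(ε_b^d·q + ε_br^d·p)) − α·ε_br^d·γ_r·r·b·(θ̂_r·p − θ̂_b·q); (blue component) D_b·((1 + ε_b^d·α·b)·q + b·Q + ε_br^d·(β_b·b·p − γ_b·r·q + r·b·(γ_r·P − γ_b·Q))) = D_b·b·(1 − γ_b·ε_br^d·r)·(b⁻¹·q + Q + α·(ε_b^d·q + ε_br^d·p)) + D_b·γ_r·ε_br^d·r·b·(r⁻¹·p + P + α·(ε_r^d·p + ε_br^d·q)) − α·ε_br^d·γ_b·r·b·(θ̂_b·q − θ̂_r·p). -/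
open Real

/-- One component of the flux identity, for arbitrary coefficients satisfying
`β₁ = α + γ₂` and `D₁ * γ₂ = D₂ * γ₁`. -/
theorem flux_component {K V : Type*} [Field K] [AddCommGroup V] [Module K V]
    {D₁ D₂ e₁ e₂ e α γ₁ γ₂ β₁ r b : K} (hβ : β₁ = α + γ₂) (hγ : D₁ * γ₂ = D₂ * γ₁)
    (hr : r ≠ 0) (hb : b ≠ 0) (p q P Q : V) :
    D₁ • ((1 + e₁ * α * r) • p + r • P
        + e • ((β₁ * r) • q - (γ₁ * b) • p + (r * b) • (γ₂ • Q - γ₁ • P)))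
      = (D₁ * r * (1 - γ₁ * e * b)) • (r⁻¹ • p + P + α • (e₁ • p + e • q))
        + (D₁ * γ₂ * e * r * b) • (b⁻¹ • q + Q + α • (e₂ • q + e • p))
        - (α * e * γ₁ * r * b) • ((D₂ * e - D₁ * e₁) • p - (D₁ * e - D₂ * e₂) • q) := by
  subst hβ
  match_scalars
  · field_simp
    linear_combination (-α * e ^ 2 * r * b) * hγ
  · ring
  · field_simp
    linear_combination (-α * e * e₂ * b) * hγ
  · ring

/-- Pointwise flux identities underlying equation (2.13) of the paper: the flux of the
general cross-diffusion system (2.4) equals the gradient-flow flux `M_ε ∇(∂E_ε)` minus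
the order-`ε^{2d}` remainder `G` of equation (2.14). The vectors `p, q, P, Q` stand for
`∇r, ∇b, ∇V_r, ∇V_b` at a point. -/
theorem general_flux_identities
    {E : Type*} [NormedAddCommGroup E] [InnerProductSpace ℝ E]
    (d : ℕ) (hd : 1 ≤ d)
    (Dr Db εr εb : ℝ) (hDr : 0 < Dr) (hDb : 0 < Db) (hεr : 0 < εr) (hεb : 0 < εb)
    (α γr γb βr βb εbr θr θb : ℝ)
    (hα : α = 2 * (d - 1 : ℝ) * π / d)
    (hγr : γr = (2 * π / d) * Dr / (Dr + Db))
    (hγb : γb = (2 * π / d) * Db / (Dr + Db))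
    (hβr : βr = (2 * π / d) * ((d - 1 : ℝ) * Dr + d * Db) / (Dr + Db))
    (hβb : βb = (2 * π / d) * ((d - 1 : ℝ) * Db + d * Dr) / (Dr + Db))
    (hεbr : εbr = (εr + εb) / 2)
    (hθr : θr = Db * εbr ^ d - Dr * εr ^ d)
    (hθb : θb = Dr * εbr ^ d - Db * εb ^ d)
    (r b : ℝ) (hr : 0 < r) (hb : 0 < b) (p q P Q : E) :
    (Dr • ((1 + εr ^ d * α * r) • p + r • P
        + εbr ^ d • ((βr * r) • q - (γr * b) • p + (r * b) • (γb • Q - γr • P)))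
      = (Dr * r * (1 - γr * εbr ^ d * b)) • (r⁻¹ • p + P + α • (εr ^ d • p + εbr ^ d • q))
        + (Dr * γb * εbr ^ d * r * b) • (b⁻¹ • q + Q + α • (εb ^ d • q + εbr ^ d • p))
        - (α * εbr ^ d * γr * r * b) • (θr • p - θb • q)) ∧
    (Db • ((1 + εb ^ d * α * b) • q + b • Q
        + εbr ^ d • ((βb * b) • p - (γb * r) • q + (r * b) • (γr • P - γb • Q)))
      = (Db * b * (1 - γb * εbr ^ d * r)) • (b⁻¹ • q + Q + α • (εb ^ d • q + εbr ^ d • p))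
        + (Db * γr * εbr ^ d * r * b) • (r⁻¹ • p + P + α • (εr ^ d • p + εbr ^ d • q))
        - (α * εbr ^ d * γb * r * b) • (θb • q - θr • p)) := by
  have hd' : (d : ℝ) ≠ 0 := by positivity
  have hD : Dr + Db ≠ 0 := by positivity
  have hβγr : βr = α + γb := by
    rw [hβr, hα, hγb]
    field_simp
    ring
  have hβγb : βb = α + γr := by
    rw [hβb, hα, hγr]
    field_simp
    ring
  have hγ : Dr * γb = Db * γr := by
    rw [hγb, hγr]
    ring
  rw [hθr, hθb]
  refine ⟨flux_component hβγr hγ hr.ne' hb.ne' p q P Q, ?_⟩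
  rw [mul_comm r b, mul_right_comm _ r b, mul_right_comm _ r b]
  exact flux_component hβγb hγ.symm hb.ne' hr.ne' q p Q P
end

section
/- Let ᾱ > 0 and V_r, V_b be reals. The entropy-variable map (r,b) ↦ (log r + ᾱ(r+b) + V_r, log b + ᾱ(r+b) + V_b) is a bijection from the open quadrant Q = {(r,b) ∈ ℝ × ℝ : r > 0, b > 0} onto ℝ × ℝ. -/
/-- The total density is determined by the entropy variables: if two points of the quadrant have
the same image, neither can have the smaller total density. -/
theorem add_le_add_of_log_add_mul_eq {a c d r b r' b' : ℝ} (ha : 0 < a)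
    (hr : 0 < r) (hb : 0 < b) (hr' : 0 < r') (hb' : 0 < b')
    (h₁ : Real.log r + a * (r + b) + c = Real.log r' + a * (r' + b') + c)
    (h₂ : Real.log b + a * (r + b) + d = Real.log b' + a * (r' + b') + d) :
    r' + b' ≤ r + b := by
  by_contra! h
  have hs := mul_lt_mul_of_pos_left h ha
  have hlt₁ : r' < r := (Real.log_lt_log_iff hr' hr).1 (by linarith)
  have hlt₂ : b' < b := (Real.log_lt_log_iff hb' hb).1 (by linarith)
  linarith

/-- The equation `s = C * exp (-(a * s))` has a solution when `a` and `C` are nonnegative. -/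
theorem exists_eq_mul_exp_neg_mul {a C : ℝ} (ha : 0 ≤ a) (hC : 0 ≤ C) :
    ∃ s : ℝ, s = C * Real.exp (-(a * s)) := by
  have hcont : ContinuousOn (fun s : ℝ => s - C * Real.exp (-(a * s))) (Set.Icc 0 C) := by
    fun_prop
  have hle : Real.exp (-(a * C)) ≤ 1 :=
    Real.exp_le_one_iff.2 (neg_nonpos.2 (mul_nonneg ha hC))
  obtain ⟨s, -, hs⟩ := intermediate_value_Icc hC hcont
    (show (0 : ℝ) ∈ Set.Icc _ _ from
      ⟨by simpa using hC, sub_nonneg.2 (mul_le_of_le_one_right hC hle)⟩)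
  exact ⟨s, sub_eq_zero.1 hs⟩

/-- The entropy-variable map `(r,b) ↦ (u,v) = (log r + ᾱ(r+b) + V_r, log b + ᾱ(r+b) + V_b)`
of the symmetric cross-diffusion system (equations (2.11)–(2.12) of the paper) is a
bijection from the open quadrant `Q = {(r,b) : r > 0, b > 0}` onto `ℝ × ℝ`. -/
theorem entropy_variable_map_bijOn
    (ᾱ Vr Vb : ℝ) (hᾱ : 0 < ᾱ) :
    Set.BijOn
      (fun p : ℝ × ℝ =>
        (Real.log p.1 + ᾱ * (p.1 + p.2) + Vr,
         Real.log p.2 + ᾱ * (p.1 + p.2) + Vb))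
      {p : ℝ × ℝ | 0 < p.1 ∧ 0 < p.2}
      Set.univ := by
  refine ⟨Set.mapsTo_univ _ _, ?_, ?_⟩
  · rintro ⟨r, b⟩ ⟨hr, hb⟩ ⟨r', b'⟩ ⟨hr', hb'⟩ h
    obtain ⟨h₁, h₂⟩ := Prod.mk.inj h
    dsimp only at hr hb hr' hb' h₁ h₂
    have hs : r + b = r' + b' := le_antisymm
      (add_le_add_of_log_add_mul_eq hᾱ hr' hb' hr hb h₁.symm h₂.symm)
      (add_le_add_of_log_add_mul_eq hᾱ hr hb hr' hb' h₁ h₂)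
    rw [hs] at h₁ h₂
    exact Prod.ext (Real.log_injOn_pos hr hr' (by linarith))
      (Real.log_injOn_pos hb hb' (by linarith))
  · rintro ⟨u, v⟩ -
    obtain ⟨s, hs⟩ := exists_eq_mul_exp_neg_mul (C := Real.exp (u - Vr) + Real.exp (v - Vb))
      hᾱ.le (by positivity)
    rw [add_mul, ← Real.exp_add, ← Real.exp_add] at hs
    refine ⟨(Real.exp (u - Vr + -(ᾱ * s)), Real.exp (v - Vb + -(ᾱ * s))),
      ⟨Real.exp_pos _, Real.exp_pos _⟩, ?_⟩
    dsimp only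
    rw [← hs, Real.log_exp, Real.log_exp]
    ext <;> dsimp only <;> ring
end
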